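/- Let α > 2, ε ∈ [0,1), σ² > 0, M > 0, K > 0 and γ > 0. If 0 < ρ₁ < ρ₂ and M(1−ε²)² − B₂(M,K,ρ₁)γ > 0 (hence also M(1−ε²)² − B₂(M,K,ρ₂)γ > 0), then β*(M,K,ρ₂) < β*(M,K,ρ₁); i.e., the EE-optimal pilot reuse factor is strictly decreasing in the power-control coefficient ρ. -/

import Mathlib

/-- `B₁(M,K,ρ) = 4K/(α−2)² + (K + M(1−ε²))/(α−1) + 2(K + σ²/ρ)/(α−2)` -/
noncomputable def B1 (α ε σ2 M K ρ : ℝ) : ℝ :=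
  4*K/(α-2)^2 + (K + M*(1-ε^2))/(α-1) + 2*(K + σ2/ρ)/(α-2)

/-- `B₂(M,K,ρ) = (K + σ²/ρ + 2K/(α−2))(1 + σ²/ρ) + (1−ε²)ε²M` -/
noncomputable def B2 (α ε σ2 M K ρ : ℝ) : ℝ :=
  (K + σ2/ρ + 2*K/(α-2))*(1 + σ2/ρ) + (1-ε^2)*ε^2*M

/-- `β*(M,K,ρ) = B₁(M,K,ρ)γ / (M(1−ε²)² − B₂(M,K,ρ)γ)` -/
noncomputable def betaStar (α ε σ2 γ M K ρ : ℝ) : ℝ :=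
  B1 α ε σ2 M K ρ * γ / (M*(1-ε^2)^2 - B2 α ε σ2 M K ρ * γ)

theorem B1_pos {α ε σ2 M K ρ : ℝ} (hα : 2 < α) (hε0 : 0 ≤ ε) (hε1 : ε < 1) (hσ : 0 < σ2)
    (hM : 0 < M) (hK : 0 < K) (hρ : 0 < ρ) : 0 < B1 α ε σ2 M K ρ := by
  have hα2 : 0 < α - 2 := by linarith
  have hα1 : 0 < α - 1 := by linarith
  have hε : 0 < 1 - ε ^ 2 := by nlinarith
  unfold B1
  positivity

theorem B1_strictAntiOn {α σ2 : ℝ} (ε M K : ℝ) (hα : 2 < α) (hσ : 0 < σ2) :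
    StrictAntiOn (B1 α ε σ2 M K) (Set.Ioi 0) := by
  intro ρ hρ ρ' _ hlt
  have hα2 : 0 < α - 2 := by linarith
  have hdiv : σ2 / ρ' < σ2 / ρ := div_lt_div_of_pos_left hσ hρ hlt
  unfold B1
  gcongr

theorem B2_strictAntiOn {α σ2 K : ℝ} (ε M : ℝ) (hα : 2 < α) (hσ : 0 < σ2) (hK : 0 < K) :
    StrictAntiOn (B2 α ε σ2 M K) (Set.Ioi 0) := by
  intro ρ hρ ρ' hρ' hlt
  have hα2 : 0 < α - 2 := by linarith
  have hdiv : σ2 / ρ' < σ2 / ρ := div_lt_div_of_pos_left hσ hρ hlt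
  have hdiv_pos : 0 < σ2 / ρ' := div_pos hσ hρ'
  have hinterf : 0 < 2 * K / (α - 2) := by positivity
  unfold B2
  refine add_lt_add_left (mul_lt_mul'' ?_ ?_ ?_ ?_) _ <;> linarith

/-- the EE-optimal pilot reuse factor is strictly decreasing in the
power-control coefficient `ρ` (for σ² > 0). -/
theorem stmt_2 (α ε σ2 M K γ ρ1 ρ2 : ℝ)
    (hα : 2 < α) (hε0 : 0 ≤ ε) (hε1 : ε < 1) (hσ : 0 < σ2)
    (hM : 0 < M) (hK : 0 < K) (hγ : 0 < γ)
    (hρ1 : 0 < ρ1) (hρ12 : ρ1 < ρ2)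
    (hpos1 : 0 < M*(1-ε^2)^2 - B2 α ε σ2 M K ρ1 * γ) :
    0 < M*(1-ε^2)^2 - B2 α ε σ2 M K ρ2 * γ ∧
      betaStar α ε σ2 γ M K ρ2 < betaStar α ε σ2 γ M K ρ1 := by
  have hρ2 : 0 < ρ2 := hρ1.trans hρ12
  have hB1 := B1_strictAntiOn ε M K hα hσ hρ1 hρ2 hρ12
  have hB2 := B2_strictAntiOn ε M hα hσ hK hρ1 hρ2 hρ12
  have hB2γ := mul_lt_mul_of_pos_right hB2 hγ
  have hB1_pos := B1_pos hα hε0 hε1 hσ hM hK hρ1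
  refine ⟨by linarith, ?_⟩
  exact div_lt_div₀ (mul_lt_mul_of_pos_right hB1 hγ) (by linarith)
    (mul_pos hB1_pos hγ).le hpos1
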